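/- arXiv:2006.07047 — 2 statements merged into one kernel-verified Lean document; each statement's English description precedes it below -/
import Mathlib

section
/- Strong WAY theorem (commutator form): Let U be a unitary operator on H_S⊗H_A, φ ∈ H_A a unit vector, Z any bounded operator on H_A, and L_S a self-adjoint operator on H_S. If U commutes with L_S⊗1, then the measured effect E := Γ_φ(U^*(1⊗Z)U) commutes with L_S: [E, L_S] = 0. -/
open scoped InnerProductSpace
open ContinuousLinearMap

noncomputable section

/-- An abstract tensor product structure realising the Hilbert space `H` as the tensor
product of the Hilbert spaces `E` and `F`, with the induced inner product
`⟪x⊗y, x'⊗y'⟫ = ⟪x,x'⟫⟪y,y'⟫`, and with the induced action `tmap B C = B ⊗ C` of pairs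
of operators. -/
structure TensorStruct (E F H : Type*)
    [NormedAddCommGroup E] [InnerProductSpace ℂ E]
    [NormedAddCommGroup F] [InnerProductSpace ℂ F]
    [NormedAddCommGroup H] [InnerProductSpace ℂ H] where
  tmul : E →ₗ[ℂ] F →ₗ[ℂ] H
  inner_tmul : ∀ (x x' : E) (y y' : F),
    ⟪tmul x y, tmul x' y'⟫_ℂ = ⟪x, x'⟫_ℂ * ⟪y, y'⟫_ℂ
  span_tmul : Submodule.span ℂ {z : H | ∃ x y, z = tmul x y} = ⊤
  tmap : (E →L[ℂ] E) → (F →L[ℂ] F) → (H →L[ℂ] H)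
  tmap_tmul : ∀ (B : E →L[ℂ] E) (C : F →L[ℂ] F) (x : E) (y : F),
    tmap B C (tmul x y) = tmul (B x) (C y)

namespace TensorStruct

variable {E F H : Type*}
  [NormedAddCommGroup E] [InnerProductSpace ℂ E]
  [NormedAddCommGroup F] [InnerProductSpace ℂ F]
  [NormedAddCommGroup H] [InnerProductSpace ℂ H]

/-- Continuous linear maps agreeing on simple tensors are equal. -/
theorem clm_ext {G : Type*} [NormedAddCommGroup G] [NormedSpace ℂ G]
    (T : TensorStruct E F H) {A B : H →L[ℂ] G}
    (h : ∀ x y, A (T.tmul x y) = B (T.tmul x y)) : A = B := by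
  apply ContinuousLinearMap.coe_injective
  apply LinearMap.ext_on T.span_tmul
  rintro _ ⟨x, y, rfl⟩
  exact h x y

/-- The operators `B ⊗ 1` and `1 ⊗ C` commute. -/
theorem commute_tmap (T : TensorStruct E F H) (B : E →L[ℂ] E) (C : F →L[ℂ] F) :
    Commute (T.tmap B 1) (T.tmap 1 C) :=
  T.clm_ext fun x y => by simp [T.tmap_tmul]

/-- Moving `B ⊗ C` across the inner product with a simple tensor. -/
theorem inner_tmul_tmap [CompleteSpace E] [CompleteSpace F] (T : TensorStruct E F H)
    (B : E →L[ℂ] E) (C : F →L[ℂ] F) (x : E) (y : F) (v : H) :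
    ⟪T.tmul x y, T.tmap B C v⟫_ℂ = ⟪T.tmul (adjoint B x) (adjoint C y), v⟫_ℂ := by
  have h : innerSL ℂ (T.tmul x y) ∘L T.tmap B C =
      innerSL ℂ (T.tmul (adjoint B x) (adjoint C y)) :=
    T.clm_ext fun x' y' => by
      simp [T.tmap_tmul, T.inner_tmul, adjoint_inner_left]
  simpa using DFunLike.congr_fun h v

end TensorStruct

/-- **Strong WAY theorem (commutator form).**
If the unitary coupling `U` commutes with `L_S⊗1`, then the measured effect
`E = Γ_φ(U^*(1⊗Z)U)` commutes with `L_S`: `[E, L_S] = 0`. -/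
theorem strong_WAY_commutator
    {HS HA H : Type*}
    [NormedAddCommGroup HS] [InnerProductSpace ℂ HS] [FiniteDimensional ℂ HS]
    [NormedAddCommGroup HA] [InnerProductSpace ℂ HA] [FiniteDimensional ℂ HA]
    [NormedAddCommGroup H] [InnerProductSpace ℂ H] [FiniteDimensional ℂ H]
    (T : TensorStruct HS HA H)
    (U : H →L[ℂ] H) (hU : adjoint U * U = 1 ∧ U * adjoint U = 1)
    (φ : HA) (hφ : ‖φ‖ = 1)
    (Z : HA →L[ℂ] HA)
    (LS : HS →L[ℂ] HS) (hLS : adjoint LS = LS)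
    -- `U` commutes with `L_S⊗1`
    (hcons : U * T.tmap LS 1 = T.tmap LS 1 * U)
    -- the measured effect `E := Γ_φ(U^*(1⊗Z)U)`
    (E : HS →L[ℂ] HS)
    (hE : ∀ ψ ψ' : HS,
      ⟪ψ, E ψ'⟫_ℂ = ⟪T.tmul ψ φ, (adjoint U * T.tmap 1 Z * U) (T.tmul ψ' φ)⟫_ℂ) :
    E * LS - LS * E = 0 := by
  have hUL : Commute U (T.tmap LS 1) := hcons
  have hUL' : Commute (adjoint U) (T.tmap LS 1) :=
    hUL.units_inv_left (u := ⟨U, adjoint U, hU.2, hU.1⟩)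
  have hW : Commute (adjoint U * T.tmap 1 Z * U) (T.tmap LS 1) :=
    (hUL'.mul_left (T.commute_tmap LS Z).symm).mul_left hUL
  rw [sub_eq_zero]
  ext ψ'
  refine ext_inner_left ℂ fun ψ => ?_
  calc ⟪ψ, E (LS ψ')⟫_ℂ
      = ⟪T.tmul ψ φ, (adjoint U * T.tmap 1 Z * U * T.tmap LS 1) (T.tmul ψ' φ)⟫_ℂ := by
        rw [hE, mul_apply_eq_comp (adjoint U * T.tmap 1 Z * U), T.tmap_tmul, one_apply_eq_self]
    _ = ⟪T.tmul (adjoint LS ψ) (adjoint 1 φ),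
          (adjoint U * T.tmap 1 Z * U) (T.tmul ψ' φ)⟫_ℂ := by
        rw [hW.eq, mul_apply_eq_comp, T.inner_tmul_tmap]
    _ = ⟪ψ, LS (E ψ')⟫_ℂ := by
        rw [← adjoint_inner_left LS, hE, adjoint_one, one_apply_eq_self]

end
end

section
/- Invariance of relativised observables: Let G be a finite group, g ↦ U_S(g) and g ↦ U_R(g) unitary representations of G on H_S and H_R, and (Q_g)_{g∈G} a covariant family of operators on H_R, i.e. U_R(h) Q_g U_R(h)^* = Q_{hg} for all g, h ∈ G. Then for every operator A on H_S and every h ∈ G, (U_S(h)⊗U_R(h)) ∘ ¥(A) ∘ (U_S(h)⊗U_R(h))^* = ¥(A); that is, ¥(A) is invariant under the diagonal symmetry action. -/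
open scoped InnerProductSpace
open ContinuousLinearMap

noncomputable section

/-- The relativisation map `¥`, sending an operator `A` on `H_S` to the operator
`¥(A) = ∑ g, (U_S(g) A U_S(g)^*) ⊗ Q_g` on `H_S⊗H_R`. -/
def yen {HS HR H : Type*}
    [NormedAddCommGroup HS] [InnerProductSpace ℂ HS] [FiniteDimensional ℂ HS]
    [NormedAddCommGroup HR] [InnerProductSpace ℂ HR] [FiniteDimensional ℂ HR]
    [NormedAddCommGroup H] [InnerProductSpace ℂ H] [FiniteDimensional ℂ H]
    (T : TensorStruct HS HR H)
    {G : Type*} [Group G] [Fintype G]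
    (US : G → (HS →L[ℂ] HS)) (Q : G → (HR →L[ℂ] HR))
    (A : HS →L[ℂ] HS) : H →L[ℂ] H :=
  ∑ g : G, T.tmap (US g * A * adjoint (US g)) (Q g)

namespace TensorStruct

variable {E F H : Type*}
  [NormedAddCommGroup E] [InnerProductSpace ℂ E]
  [NormedAddCommGroup F] [InnerProductSpace ℂ F]
  [NormedAddCommGroup H] [InnerProductSpace ℂ H]
  (T : TensorStruct E F H)

/-- Two operators that agree on all product vectors are equal. -/
theorem ext_tmul {K L : H →L[ℂ] H}
    (h : ∀ x y, K (T.tmul x y) = L (T.tmul x y)) : K = L := by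
  have hlin : (K : H →ₗ[ℂ] H) = (L : H →ₗ[ℂ] H) := by
    refine LinearMap.ext_on T.span_tmul ?_
    rintro _ ⟨x, y, rfl⟩
    exact h x y
  exact ContinuousLinearMap.coe_injective hlin

/-- A vector is determined by its inner products with all product vectors. -/
theorem ext_inner_tmul {u v : H}
    (h : ∀ x y, ⟪T.tmul x y, u⟫_ℂ = ⟪T.tmul x y, v⟫_ℂ) : u = v := by
  refine ext_inner_left ℂ fun z => ?_
  have hz : z ∈ Submodule.span ℂ {z : H | ∃ x y, z = T.tmul x y} := by
    rw [T.span_tmul]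
    trivial
  induction hz using Submodule.span_induction with
  | mem z hz =>
    obtain ⟨x, y, rfl⟩ := hz
    exact h x y
  | zero => simp
  | add a b _ _ ha hb => rw [inner_add_left, inner_add_left, ha, hb]
  | smul c a _ ha => rw [inner_smul_left, inner_smul_left, ha]

theorem tmap_mul_tmap (B B' : E →L[ℂ] E) (C C' : F →L[ℂ] F) :
    T.tmap B C * T.tmap B' C' = T.tmap (B * B') (C * C') :=
  T.ext_tmul fun x y => by simp [T.tmap_tmul]

theorem adjoint_tmap [CompleteSpace E] [CompleteSpace F] [CompleteSpace H]
    (B : E →L[ℂ] E) (C : F →L[ℂ] F) :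
    adjoint (T.tmap B C) = T.tmap (adjoint B) (adjoint C) :=
  T.ext_tmul fun x y => T.ext_inner_tmul fun x' y' => by
    simp [adjoint_inner_right, T.tmap_tmul, T.inner_tmul]

end TensorStruct

/-- **Invariance of relativised observables.**
For unitary representations `U_S`, `U_R` of a finite group `G` and a covariant family
`(Q_g)` of operators on `H_R` (`U_R(h) Q_g U_R(h)^* = Q_{hg}`), every relativised
observable `¥(A)` is invariant under the diagonal symmetry action:
`(U_S(h)⊗U_R(h)) ¥(A) (U_S(h)⊗U_R(h))^* = ¥(A)`. -/
theorem relativised_invariant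
    {HS HR H : Type*}
    [NormedAddCommGroup HS] [InnerProductSpace ℂ HS] [FiniteDimensional ℂ HS]
    [NormedAddCommGroup HR] [InnerProductSpace ℂ HR] [FiniteDimensional ℂ HR]
    [NormedAddCommGroup H] [InnerProductSpace ℂ H] [FiniteDimensional ℂ H]
    (T : TensorStruct HS HR H)
    {G : Type*} [Group G] [Fintype G]
    -- `U_S` is a unitary representation of `G` on `H_S`
    (US : G → (HS →L[ℂ] HS))
    (hUS1 : US 1 = 1)
    (hUSmul : ∀ g h : G, US (g * h) = US g * US h)
    (hUSuni : ∀ g : G, adjoint (US g) * US g = 1 ∧ US g * adjoint (US g) = 1)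
    -- `U_R` is a unitary representation of `G` on `H_R`
    (UR : G → (HR →L[ℂ] HR))
    (hUR1 : UR 1 = 1)
    (hURmul : ∀ g h : G, UR (g * h) = UR g * UR h)
    (hURuni : ∀ g : G, adjoint (UR g) * UR g = 1 ∧ UR g * adjoint (UR g) = 1)
    -- `(Q_g)` is a covariant family of operators on `H_R`
    (Q : G → (HR →L[ℂ] HR))
    (hQcov : ∀ g h : G, UR h * Q g * adjoint (UR h) = Q (h * g)) :
    ∀ (A : HS →L[ℂ] HS) (h : G),
      T.tmap (US h) (UR h) * yen T US Q A * adjoint (T.tmap (US h) (UR h))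
        = yen T US Q A := by
  intro A h
  simp only [yen, Finset.mul_sum, Finset.sum_mul, T.adjoint_tmap, T.tmap_mul_tmap, hQcov]
  refine Fintype.sum_equiv (Equiv.mulLeft h) _ _ fun g => ?_
  have hadj : adjoint (US h * US g) = adjoint (US g) * adjoint (US h) :=
    adjoint_comp (US h) (US g)
  simp only [Equiv.coe_mulLeft, hUSmul, hadj, mul_assoc]

end
end
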